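/- Let G : S¹ × (a,b) → ℝ be given by G(ζ, s) = ⟨φ(1,s), ζ⟩. Then for every ζ = (ζ₁,ζ₂) ∈ S¹ and every s ∈ (a,b): α₁² · det(ζ₁ Hess φ₁(1,s) + ζ₂ Hess φ₂(1,s)) = m(m−α₁) G(ζ,s) G_{ss}(ζ,s) + α₂(α₁−α₂) s G_s(ζ,s) G_{ss}(ζ,s) − (m−α₂)² G_s(ζ,s)², where G_s and G_{ss} denote the first and second partial derivatives of G with respect to s. -/

import Mathlib

open MeasureTheory Real Set
open scoped ENNReal

noncomputable section

/-- Nonisotropic dilation `t ∙ x = (t^{α₁} x₁, t^{α₂} x₂)` (for `t > 0`). -/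
def dil (α₁ α₂ t : ℝ) (x : Fin 2 → ℝ) : Fin 2 → ℝ :=
  ![t ^ α₁ * x 0, t ^ α₂ * x 1]

/-- The region `V^{a,b} = { t ∙ (1,s) : s ∈ (a,b), t > 0 }`. -/
def Vab (α₁ α₂ a b : ℝ) : Set (Fin 2 → ℝ) :=
  {x | ∃ s t : ℝ, a < s ∧ s < b ∧ 0 < t ∧ x = dil α₁ α₂ t ![1, s]}

/-- The region `V₁^{c,d} = { t ∙ (1,s) : s ∈ (c,d), 0 < t < 1 }`. -/
def V1 (α₁ α₂ c d : ℝ) : Set (Fin 2 → ℝ) :=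
  {x | ∃ s t : ℝ, c < s ∧ s < d ∧ 0 < t ∧ t < 1 ∧ x = dil α₁ α₂ t ![1, s]}

/-- Membership in the unit circle `S¹ ⊂ ℝ²`. -/
def onS1 (ζ : Fin 2 → ℝ) : Prop := ζ 0 ^ 2 + ζ 1 ^ 2 = 1

/-- The standard inner product on `ℝ²`. -/
def dot2 (u v : Fin 2 → ℝ) : ℝ := u 0 * v 0 + u 1 * v 1

/-- Hessian matrix of second partial derivatives of `f` at `x`. -/
def Hess (f : (Fin 2 → ℝ) → ℝ) (x : Fin 2 → ℝ) : Matrix (Fin 2) (Fin 2) ℝ :=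
  Matrix.of fun i j => fderiv ℝ (fun y => fderiv ℝ f y (Pi.single j 1)) x (Pi.single i 1)

/-- The form `Q_x(ζ) = det (ζ₁ Hess φ₁(x) + ζ₂ Hess φ₂(x))`. -/
def Qform (φ : (Fin 2 → ℝ) → Fin 2 → ℝ) (x ζ : Fin 2 → ℝ) : ℝ :=
  (ζ 0 • Hess (fun y => φ y 0) x + ζ 1 • Hess (fun y => φ y 1) x).det

/-- `x` is an elliptic point for `φ`: `min_{ζ ∈ S¹} |Q_x(ζ)| > 0`. -/
def Elliptic (φ : (Fin 2 → ℝ) → Fin 2 → ℝ) (x : Fin 2 → ℝ) : Prop :=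
  ∃ ε : ℝ, 0 < ε ∧ ∀ ζ : Fin 2 → ℝ, onS1 ζ → ε ≤ |Qform φ x ζ|

/-- The symmetric matrix `K(x)` associated with the quadratic form `Q_x`,
i.e. the matrix with entries `k₁₁ = det Hess φ₁`, `k₂₂ = det Hess φ₂`,
`k₁₂ = k₂₁ = ½(∂₁₁φ₁ ∂₂₂φ₂ + ∂₂₂φ₁ ∂₁₁φ₂ − 2 ∂₁₂φ₁ ∂₁₂φ₂)`, which satisfies
`Q_x(ζ) = ⟨K(x)ζ, ζ⟩`. -/
def Kmat (φ : (Fin 2 → ℝ) → Fin 2 → ℝ) (x : Fin 2 → ℝ) : Matrix (Fin 2) (Fin 2) ℝ :=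
  Matrix.of
    ![![(Hess (fun y => φ y 0) x).det,
        ((Hess (fun y => φ y 0) x) 0 0 * (Hess (fun y => φ y 1) x) 1 1
          + (Hess (fun y => φ y 0) x) 1 1 * (Hess (fun y => φ y 1) x) 0 0
          - 2 * (Hess (fun y => φ y 0) x) 0 1 * (Hess (fun y => φ y 1) x) 0 1) / 2],
      ![((Hess (fun y => φ y 0) x) 0 0 * (Hess (fun y => φ y 1) x) 1 1
          + (Hess (fun y => φ y 0) x) 1 1 * (Hess (fun y => φ y 1) x) 0 0
          - 2 * (Hess (fun y => φ y 0) x) 0 1 * (Hess (fun y => φ y 1) x) 0 1) / 2,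
        (Hess (fun y => φ y 1) x).det]]

/-- The function `G(ζ,s) = ⟨φ(1,s), ζ⟩`. -/
def Gfun (φ : (Fin 2 → ℝ) → Fin 2 → ℝ) (ζ : Fin 2 → ℝ) (s : ℝ) : ℝ :=
  dot2 (φ ![1, s]) ζ

/-- The standard inner product on `ℝ⁴`. -/
def dot4 (u v : Fin 4 → ℝ) : ℝ := u 0 * v 0 + u 1 * v 1 + u 2 * v 2 + u 3 * v 3

/-- The graph map `x ↦ (x, φ(x)) ∈ ℝ⁴`. -/
def graphMap (φ : (Fin 2 → ℝ) → Fin 2 → ℝ) (x : Fin 2 → ℝ) : Fin 4 → ℝ :=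
  ![x 0, x 1, φ x 0, φ x 1]

/-- The Fourier transform on `ℝ⁴`, `ĝ(ξ) = ∫ e^{-i⟨x,ξ⟩} g(x) dx`. -/
def ftrans (g : (Fin 4 → ℝ) → ℂ) (ξ : Fin 4 → ℝ) : ℂ :=
  ∫ x : Fin 4 → ℝ, Complex.exp (-Complex.I * (dot4 x ξ : ℂ)) * g x

/-- The Fourier transform of the measure `μ`,
`μ̂(ξ) = ∫_{V₁^{c,d}} e^{-i⟨(x,φ(x)),ξ⟩} dx`. -/
def muHat (α₁ α₂ c d : ℝ) (φ : (Fin 2 → ℝ) → Fin 2 → ℝ) (ξ : Fin 4 → ℝ) : ℂ :=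
  ∫ x in V1 α₁ α₂ c d, Complex.exp (-Complex.I * (dot4 (graphMap φ x) ξ : ℂ))

/-- Convolution with the measure `μ`: `(μ ∗ g)(y) = ∫_{V₁^{c,d}} g(y − (x, φ(x))) dx`. -/
def muConv (α₁ α₂ c d : ℝ) (φ : (Fin 2 → ℝ) → Fin 2 → ℝ) (g : (Fin 4 → ℝ) → ℂ)
    (y : Fin 4 → ℝ) : ℂ :=
  ∫ x in V1 α₁ α₂ c d, g (y - graphMap φ x)


/-- The function `H(ζ,s)` of Remark 2.4 / Statement 19, built from `G(ζ,s) = ⟨φ(1,s),ζ⟩`. -/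
def Hfun (α₁ α₂ m : ℝ) (φ : (Fin 2 → ℝ) → Fin 2 → ℝ) (ζ : Fin 2 → ℝ) (s : ℝ) : ℝ :=
  m * (m - α₁) * Gfun φ ζ s * deriv (deriv (Gfun φ ζ)) s
    + α₂ * (α₁ - α₂) * s * deriv (Gfun φ ζ) s * deriv (deriv (Gfun φ ζ)) s
    - (m - α₂) ^ 2 * (deriv (Gfun φ ζ) s) ^ 2

open scoped Topology

/-- The first partial derivative `∂ⱼ f`. -/
def partialDeriv (f : (Fin 2 → ℝ) → ℝ) (j : Fin 2) (y : Fin 2 → ℝ) : ℝ :=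
  fderiv ℝ f y (Pi.single j 1)

lemma Hess_apply (f : (Fin 2 → ℝ) → ℝ) (x : Fin 2 → ℝ) (i j : Fin 2) :
    Hess f x i j = partialDeriv (partialDeriv f j) i x := rfl

lemma fderiv_apply_fin_two (f : (Fin 2 → ℝ) → ℝ) (y v : Fin 2 → ℝ) :
    fderiv ℝ f y v = v 0 * partialDeriv f 0 y + v 1 * partialDeriv f 1 y := by
  have hv : v = v 0 • Pi.single 0 1 + v 1 • Pi.single 1 1 := by
    ext i; fin_cases i <;> simp
  conv_lhs => rw [hv]
  simp [partialDeriv]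

lemma dil_one (α₁ α₂ : ℝ) (y : Fin 2 → ℝ) : dil α₁ α₂ 1 y = y := by
  ext i; fin_cases i <;> simp [dil]

lemma hasDerivAt_dil_one (α₁ α₂ : ℝ) (y : Fin 2 → ℝ) :
    HasDerivAt (fun t => dil α₁ α₂ t y) ![α₁ * y 0, α₂ * y 1] 1 := by
  have hpow (α c : ℝ) : HasDerivAt (fun t : ℝ => t ^ α * c) (α * c) 1 := by
    simpa using (Real.hasDerivAt_rpow_const (x := 1) (p := α) (Or.inl one_ne_zero)).mul_const c
  rw [hasDerivAt_pi]
  intro i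
  fin_cases i
  · simpa [dil] using hpow α₁ (y 0)
  · simpa [dil] using hpow α₂ (y 1)

/-- Euler's identity for functions homogeneous under nonisotropic dilations. -/
lemma euler_identity {α₁ α₂ m : ℝ} {f : (Fin 2 → ℝ) → ℝ} {y : Fin 2 → ℝ}
    (hf : DifferentiableAt ℝ f y)
    (hom : ∀ t : ℝ, 0 < t → f (dil α₁ α₂ t y) = t ^ m * f y) :
    α₁ * y 0 * partialDeriv f 0 y + α₂ * y 1 * partialDeriv f 1 y = m * f y := by
  have h₁ : HasDerivAt (fun t => f (dil α₁ α₂ t y))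
      (fderiv ℝ f y ![α₁ * y 0, α₂ * y 1]) 1 :=
    HasFDerivAt.comp_hasDerivAt_of_eq 1 hf.hasFDerivAt (hasDerivAt_dil_one α₁ α₂ y)
      (dil_one α₁ α₂ y).symm
  have h₂ : HasDerivAt (fun t : ℝ => t ^ m * f y) (m * f y) 1 := by
    simpa using
      (Real.hasDerivAt_rpow_const (x := 1) (p := m) (Or.inl one_ne_zero)).mul_const (f y)
  have h₃ : (fun t => f (dil α₁ α₂ t y)) =ᶠ[𝓝 1] fun t : ℝ => t ^ m * f y := by
    filter_upwards [lt_mem_nhds one_pos] with t ht using hom t ht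
  have h := h₁.unique (h₂.congr_of_eventuallyEq h₃)
  rw [fderiv_apply_fin_two] at h
  simpa using h

lemma AnalyticAt.partialDeriv {f : (Fin 2 → ℝ) → ℝ} {x : Fin 2 → ℝ}
    (hf : AnalyticAt ℝ f x) (j : Fin 2) : AnalyticAt ℝ (partialDeriv f j) x :=
  (ContinuousLinearMap.apply ℝ ℝ (Pi.single j (1 : ℝ) : Fin 2 → ℝ)).analyticAt _ |>.comp
    hf.fderiv

lemma partialDeriv_comm {f : (Fin 2 → ℝ) → ℝ} {x : Fin 2 → ℝ}
    (hf : AnalyticAt ℝ f x) (i j : Fin 2) :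
    partialDeriv (partialDeriv f j) i x = partialDeriv (partialDeriv f i) j x := by
  have h (k l : Fin 2) : partialDeriv (partialDeriv f l) k x =
      fderiv ℝ (fderiv ℝ f) x (Pi.single k 1) (Pi.single l 1) := by
    change fderiv ℝ (fun y => fderiv ℝ f y (Pi.single l 1)) x _ = _
    rw [fderiv_clm_apply hf.fderiv.differentiableAt (differentiableAt_const _)]
    simp
  rw [h, h]
  exact (hf.contDiffAt (n := ⊤)).isSymmSndFDerivAt (by simp) _ _

lemma partialDeriv_linear_combination {f g : (Fin 2 → ℝ) → ℝ} {x : Fin 2 → ℝ}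
    (hf : DifferentiableAt ℝ f x) (hg : DifferentiableAt ℝ g x) (c d : ℝ) (j : Fin 2) :
    partialDeriv (fun y => c * f y + d * g y) j x =
      c * partialDeriv f j x + d * partialDeriv g j x := by
  have h : HasFDerivAt (fun y => c * f y + d * g y) (c • fderiv ℝ f x + d • fderiv ℝ g x) x :=
    (hf.hasFDerivAt.const_mul c).add (hg.hasFDerivAt.const_mul d)
  simp [partialDeriv, h.fderiv]

lemma partialDeriv_congr {f g : (Fin 2 → ℝ) → ℝ} {x : Fin 2 → ℝ} (h : f =ᶠ[𝓝 x] g)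
    (j : Fin 2) : partialDeriv f j x = partialDeriv g j x := by
  simp only [partialDeriv, h.fderiv_eq]

lemma Hess_linear_combination {f g : (Fin 2 → ℝ) → ℝ} {x : Fin 2 → ℝ}
    (hf : AnalyticAt ℝ f x) (hg : AnalyticAt ℝ g x) (c d : ℝ) :
    Hess (fun y => c * f y + d * g y) x = c • Hess f x + d • Hess g x := by
  ext i j
  have h : partialDeriv (fun y => c * f y + d * g y) j =ᶠ[𝓝 x]
      fun y => c * partialDeriv f j y + d * partialDeriv g j y := by
    filter_upwards [hf.eventually_analyticAt, hg.eventually_analyticAt] with y hfy hgy using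
      partialDeriv_linear_combination hfy.differentiableAt hgy.differentiableAt c d j
  rw [Hess_apply, partialDeriv_congr h,
    partialDeriv_linear_combination (hf.partialDeriv j).differentiableAt
      (hg.partialDeriv j).differentiableAt]
  simp [Hess_apply]

lemma hasDerivAt_vertical_line {f : (Fin 2 → ℝ) → ℝ} {c s : ℝ}
    (hf : DifferentiableAt ℝ f ![c, s]) :
    HasDerivAt (fun u => f ![c, u]) (partialDeriv f 1 ![c, s]) s := by
  have h : HasDerivAt (fun u : ℝ => ![c, u]) (![0, 1] : Fin 2 → ℝ) s := by
    rw [hasDerivAt_pi]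
    intro i
    fin_cases i
    · simpa using hasDerivAt_const s c
    · exact hasDerivAt_id s
  have h' : HasDerivAt (fun u => f ![c, u]) _ s := hf.hasFDerivAt.comp_hasDerivAt s h
  rw [fderiv_apply_fin_two] at h'
  simpa using h'

lemma partialDeriv_coord_mul {g : (Fin 2 → ℝ) → ℝ} {x : Fin 2 → ℝ}
    (hg : DifferentiableAt ℝ g x) (i j : Fin 2) :
    partialDeriv (fun y => y i * g y) j x =
      (Pi.single j 1 : Fin 2 → ℝ) i * g x + x i * partialDeriv g j x := by
  have h : HasFDerivAt (fun y : Fin 2 → ℝ => y i * g y) _ x :=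
    (hasFDerivAt_apply (𝕜 := ℝ) i x).mul hg.hasFDerivAt
  simp only [partialDeriv, h.fderiv, add_apply, smul_apply,
    ContinuousLinearMap.proj_apply, smul_eq_mul]
  ring

/-- Euler's identity for the first partial derivatives. -/
lemma euler_identity_partialDeriv {α₁ α₂ m : ℝ} {f : (Fin 2 → ℝ) → ℝ} {x : Fin 2 → ℝ}
    (hf : AnalyticAt ℝ f x)
    (he : ∀ᶠ y in 𝓝 x,
      α₁ * y 0 * partialDeriv f 0 y + α₂ * y 1 * partialDeriv f 1 y = m * f y) (j : Fin 2) :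
    α₁ * ((Pi.single j 1 : Fin 2 → ℝ) 0 * partialDeriv f 0 x + x 0 * Hess f x j 0) +
      α₂ * ((Pi.single j 1 : Fin 2 → ℝ) 1 * partialDeriv f 1 x + x 1 * Hess f x j 1) =
      m * partialDeriv f j x := by
  have hd (i : Fin 2) : DifferentiableAt ℝ (partialDeriv f i) x :=
    (hf.partialDeriv i).differentiableAt
  have hc (i : Fin 2) : DifferentiableAt ℝ (fun y : Fin 2 → ℝ => y i * partialDeriv f i y) x :=
    (differentiableAt_apply i x).mul (hd i)
  have h := partialDeriv_congr (f := fun y => α₁ * (y 0 * partialDeriv f 0 y) +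
    α₂ * (y 1 * partialDeriv f 1 y)) (g := fun y => m * f y + 0 * f y)
    (he.mono fun y hy => by dsimp only; linarith) j
  rw [partialDeriv_linear_combination (hc 0) (hc 1), partialDeriv_coord_mul (hd 0),
    partialDeriv_coord_mul (hd 1),
    partialDeriv_linear_combination hf.differentiableAt hf.differentiableAt] at h
  simpa [Hess_apply] using h

/-- `V^{a,b}` contains a neighbourhood of `(1,s)` for `s ∈ (a,b)`. -/
lemma Vab_mem_nhds {α₁ α₂ a b s : ℝ} (hα₁ : α₁ ≠ 0) (hs : s ∈ Ioo a b) :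
    Vab α₁ α₂ a b ∈ 𝓝 ![1, s] := by
  have h0 : ∀ᶠ y : Fin 2 → ℝ in 𝓝 ![1, s], 0 < y 0 :=
    (continuous_apply 0).continuousAt.eventually (lt_mem_nhds (by simp))
  have hc : ContinuousAt (fun y : Fin 2 → ℝ => y 1 / (y 0 ^ α₁⁻¹) ^ α₂) ![1, s] := by
    refine (continuous_apply 1).continuousAt.div ?_ (by simp)
    refine ContinuousAt.rpow_const ?_ (by simp)
    exact (continuous_apply 0).continuousAt.rpow_const (by simp)
  have h1 := hc.eventually (Ioo_mem_nhds (a := a) (b := b) (by simpa using hs.1)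
    (by simpa using hs.2))
  filter_upwards [h0, h1] with y hy0 hy1
  have ht : 0 < y 0 ^ α₁⁻¹ := rpow_pos_of_pos hy0 _
  refine ⟨_, _, hy1.1, hy1.2, ht, ?_⟩
  ext i
  fin_cases i
  · simp [dil, Real.rpow_inv_rpow hy0.le hα₁]
  · simp [dil, mul_div_cancel₀ _ (rpow_pos_of_pos ht α₂).ne']

/-- The Hessian determinant of a homogeneous function in terms of its restriction to the line
`x₁ = 1`. -/
lemma det_Hess_of_homogeneous {α₁ α₂ m a b s : ℝ} {f : (Fin 2 → ℝ) → ℝ} (hα₁ : α₁ ≠ 0)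
    (hf : AnalyticOnNhd ℝ f (Vab α₁ α₂ a b))
    (hom : ∀ x ∈ Vab α₁ α₂ a b, ∀ t : ℝ, 0 < t → f (dil α₁ α₂ t x) = t ^ m * f x)
    (hs : s ∈ Ioo a b) :
    α₁ ^ 2 * (Hess f ![1, s]).det =
      m * (m - α₁) * f ![1, s] * deriv (deriv fun u => f ![1, u]) s
        + α₂ * (α₁ - α₂) * s * deriv (fun u => f ![1, u]) s
          * deriv (deriv fun u => f ![1, u]) s
        - (m - α₂) ^ 2 * deriv (fun u => f ![1, u]) s ^ 2 := by
  have hmem {u : ℝ} (hu : u ∈ Ioo a b) : ![1, u] ∈ Vab α₁ α₂ a b :=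
    mem_of_mem_nhds (Vab_mem_nhds hα₁ hu)
  have hfx := hf _ (hmem hs)
  have hderiv {u : ℝ} (hu : u ∈ Ioo a b) :
      deriv (fun u => f ![1, u]) u = partialDeriv f 1 ![1, u] :=
    (hasDerivAt_vertical_line (hf _ (hmem hu)).differentiableAt).deriv
  have hderiv₂ : deriv (deriv fun u => f ![1, u]) s = Hess f ![1, s] 1 1 := by
    have h : deriv (fun u => f ![1, u]) =ᶠ[𝓝 s] fun u => partialDeriv f 1 ![1, u] := by
      filter_upwards [Ioo_mem_nhds hs.1 hs.2] with u hu using hderiv hu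
    rw [h.deriv_eq, Hess_apply]
    exact (hasDerivAt_vertical_line (hfx.partialDeriv 1).differentiableAt).deriv
  have he : ∀ᶠ y in 𝓝 ![1, s],
      α₁ * y 0 * partialDeriv f 0 y + α₂ * y 1 * partialDeriv f 1 y = m * f y := by
    filter_upwards [Vab_mem_nhds hα₁ hs] with y hy using
      euler_identity (hf y hy).differentiableAt (hom y hy)
  have e := he.self_of_nhds
  have e₀ := euler_identity_partialDeriv hfx he 0
  have e₁ := euler_identity_partialDeriv hfx he 1
  have hsymm : Hess f ![1, s] 1 0 = Hess f ![1, s] 0 1 := partialDeriv_comm hfx 1 0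
  simp only [Matrix.cons_val_zero, Matrix.cons_val_one, Pi.single_eq_same, ne_eq, zero_ne_one,
    one_ne_zero, not_false_eq_true, Pi.single_eq_of_ne, mul_one, one_mul, zero_mul, zero_add,
    hsymm] at e e₀ e₁
  rw [hderiv hs, hderiv₂, Matrix.det_fin_two, hsymm]
  set F := f ![1, s]
  set p := partialDeriv f 0 ![1, s]
  set q := partialDeriv f 1 ![1, s]
  set A := Hess f ![1, s] 0 0
  set B := Hess f ![1, s] 0 1
  set C := Hess f ![1, s] 1 1
  have hB : α₁ * B = (m - α₂) * q - α₂ * s * C := by linarith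
  have hp : α₁ * p = m * F - α₂ * s * q := by linarith
  have hA : α₁ ^ 2 * A = (m - α₁) * (m * F - α₂ * s * q) -
      α₂ * s * ((m - α₂) * q - α₂ * s * C) := by
    linear_combination α₁ * e₀ + (m - α₁) * hp - α₂ * s * hB
  linear_combination C * hA - (α₁ * B + ((m - α₂) * q - α₂ * s * C)) * hB

/-- The identity
`α₁² det(ζ₁ Hess φ₁(1,s) + ζ₂ Hess φ₂(1,s)) = m(m−α₁) G G_{ss} + α₂(α₁−α₂) s G_s G_{ss} − (m−α₂)² G_s²`
for `G(ζ,s) = ⟨φ(1,s),ζ⟩`. -/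
theorem stmt_5 (α₁ α₂ m a b : ℝ) (φ : (Fin 2 → ℝ) → Fin 2 → ℝ)
    (hα₁ : 0 < α₁) (hα₂ : 0 < α₂) (hαne : α₁ ≠ α₂) (hab : a < b)
    (hm : 3 * (α₁ + α₂) ≤ m)
    (H1 : AnalyticOnNhd ℝ φ (Vab α₁ α₂ a b))
    (H2 : ∀ x ∈ Vab α₁ α₂ a b, ∀ t : ℝ, 0 < t → φ (dil α₁ α₂ t x) = t ^ m • φ x) :
    ∀ ζ : Fin 2 → ℝ, onS1 ζ → ∀ s ∈ Set.Ioo a b,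
      α₁ ^ 2 * Qform φ ![1, s] ζ =
        m * (m - α₁) * Gfun φ ζ s * deriv (deriv (Gfun φ ζ)) s
          + α₂ * (α₁ - α₂) * s * deriv (Gfun φ ζ) s * deriv (deriv (Gfun φ ζ)) s
          - (m - α₂) ^ 2 * (deriv (Gfun φ ζ) s) ^ 2 := by
  intro ζ _ s hs
  have hφ (i : Fin 2) : AnalyticOnNhd ℝ (fun y => φ y i) (Vab α₁ α₂ a b) := fun y hy =>
    analyticAt_pi_iff.1 (H1 y hy) i
  have hG : Gfun φ ζ = fun u => (fun y => ζ 0 * φ y 0 + ζ 1 * φ y 1) ![1, u] := by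
    ext u
    simp only [Gfun, dot2]
    ring
  have hx : ![1, s] ∈ Vab α₁ α₂ a b := mem_of_mem_nhds (Vab_mem_nhds hα₁.ne' hs)
  have hf : AnalyticOnNhd ℝ (fun y => ζ 0 * φ y 0 + ζ 1 * φ y 1) (Vab α₁ α₂ a b) :=
    (analyticOnNhd_const.mul (hφ 0)).add (analyticOnNhd_const.mul (hφ 1))
  rw [Qform, ← Hess_linear_combination (hφ 0 _ hx) (hφ 1 _ hx), hG]
  refine det_Hess_of_homogeneous hα₁.ne' hf (fun x hx t ht => ?_) hs
  simp only [H2 x hx t ht, Pi.smul_apply, smul_eq_mul]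
  ring

end
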